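/- Let P be a probability distribution on a finite set that is not a uniform distribution (so V(P) > 0), with H and V computed with logarithm base 2, and let b ∈ ℝ. Then lim_{n→∞} F^D(P^n → U_2^{⌊H(P)n + b√n⌋}) = lim_{n→∞} F^M(P^n → U_2^{⌊H(P)n + b√n⌋}) = √(1 − G(b/√V(P))). -/

import Mathlib

open MeasureTheory Filter

namespace RNG

variable {α β : Type*}

/-- `P` is a probability distribution on the finite set `α`. -/
def IsProb [Fintype α] (P : α → ℝ) : Prop :=
  (∀ x, 0 ≤ P x) ∧ ∑ x, P x = 1

open Classical in
/-- Pushforward distribution `W(P)(y) = ∑_{x : W x = y} P x`. -/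
noncomputable def push [Fintype α] (W : α → β) (P : α → ℝ) : β → ℝ :=
  fun y => ∑ x, if W x = y then P x else 0

/-- Fidelity (Bhattacharyya coefficient) between distributions on the same finite set. -/
noncomputable def fid [Fintype β] (R S : β → ℝ) : ℝ :=
  ∑ y, Real.sqrt (R y * S y)

/-- Sum of the `l` largest values of `P`, i.e. the `l`-th partial sum of the
decreasing rearrangement of `P` (padded with zeros). -/
noncomputable def topSum [Fintype α] (P : α → ℝ) (l : ℕ) : ℝ :=
  sSup {s : ℝ | ∃ A : Finset α, A.card ≤ l ∧ s = ∑ x ∈ A, P x}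

/-- Majorization `P ≺ P'` (the distributions may live on different finite sets). -/
def Maj [Fintype α] [Fintype β] (P : α → ℝ) (P' : β → ℝ) : Prop :=
  ∀ l : ℕ, topSum P l ≤ topSum P' l

/-- Maximal fidelity under deterministic transformations,
`F^D(P → Q) = max {F(W(P), Q) | W : α → β}`. -/
noncomputable def FD [Fintype α] [Fintype β] (P : α → ℝ) (Q : β → ℝ) : ℝ :=
  sSup {r : ℝ | ∃ W : α → β, r = fid (push W P) Q}

/-- Maximal fidelity under the majorization condition,
`F^M(P → Q) = max {F(P', Q) | P ≺ P', P'` a distribution on the target set`}`. -/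
noncomputable def FM [Fintype α] [Fintype β] (P : α → ℝ) (Q : β → ℝ) : ℝ :=
  sSup {r : ℝ | ∃ P' : β → ℝ, IsProb P' ∧ Maj P P' ∧ r = fid P' Q}

/-- Shannon entropy (natural logarithm). -/
noncomputable def H [Fintype α] (P : α → ℝ) : ℝ := ∑ x, -(P x * Real.log (P x))

/-- Varentropy `V(P)` (natural logarithm). -/
noncomputable def V [Fintype α] (P : α → ℝ) : ℝ :=
  ∑ x, P x * (-Real.log (P x) - H P) ^ 2

/-- Shannon entropy, base-2 logarithm. -/
noncomputable def H2 [Fintype α] (P : α → ℝ) : ℝ := ∑ x, -(P x * Real.logb 2 (P x))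

/-- Varentropy, base-2 logarithm. -/
noncomputable def V2 [Fintype α] (P : α → ℝ) : ℝ :=
  ∑ x, P x * (-Real.logb 2 (P x) - H2 P) ^ 2

/-- The `n`-fold i.i.d. product distribution `P^n`. -/
noncomputable def iid [Fintype α] (P : α → ℝ) (n : ℕ) : (Fin n → α) → ℝ :=
  fun f => ∏ i, P (f i)

/-- The uniform distribution on a two-element set. -/
noncomputable def U2 : Fin 2 → ℝ := fun _ => 1 / 2

/-- Density of the normal distribution `N(m, v)`. -/
noncomputable def normalPDF (m v t : ℝ) : ℝ :=
  (Real.sqrt (2 * Real.pi * v))⁻¹ * Real.exp (-(t - m) ^ 2 / (2 * v))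

/-- Standard normal cumulative distribution function `G`. -/
noncomputable def stdG (x : ℝ) : ℝ := ∫ t in Set.Iic x, normalPDF 0 1 t

/-- Density `N_P` of `N(0, V(P))`. -/
noncomputable def NP [Fintype α] (P : α → ℝ) (x : ℝ) : ℝ := normalPDF 0 (V P) x

/-- Density `N_{P,Q,b}` of `N(H(Q)b, (H(P)/H(Q))·V(Q))`. -/
noncomputable def NPQ [Fintype α] [Fintype β] (P : α → ℝ) (Q : β → ℝ) (b x : ℝ) : ℝ :=
  normalPDF (H Q * b) (H P / H Q * V Q) x

/-- Cdf `G_P(x) = G(x/√V(P))`. -/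
noncomputable def GP [Fintype α] (P : α → ℝ) (x : ℝ) : ℝ := stdG (x / Real.sqrt (V P))

/-- Cdf `G_{P,Q,b}(x) = G(√(H(Q)/(H(P)V(Q)))·(x − H(Q)b))`. -/
noncomputable def GPQ [Fintype α] [Fintype β] (P : α → ℝ) (Q : β → ℝ) (b x : ℝ) : ℝ :=
  stdG (Real.sqrt (H Q / (H P * V Q)) * (x - H Q * b))

/-- `I_{P,Q,b}(x) = ∫_{−∞}^x √(N_P(t) N_{P,Q,b}(t)) dt`. -/
noncomputable def IPQ [Fintype α] [Fintype β] (P : α → ℝ) (Q : β → ℝ) (b x : ℝ) : ℝ :=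
  ∫ t in Set.Iic x, Real.sqrt (NP P t * NPQ P Q b t)

/-- `I_{P,Q,b}(∞) = ∫_ℝ √(N_P(t) N_{P,Q,b}(t)) dt`. -/
noncomputable def IPQinf [Fintype α] [Fintype β] (P : α → ℝ) (Q : β → ℝ) (b : ℝ) : ℝ :=
  ∫ t : ℝ, Real.sqrt (NP P t * NPQ P Q b t)

/-- `L^D_n(P,Q|ν)`: the maximal `L` with `F^D(P^n → Q^L) ≥ ν`. -/
noncomputable def LD [Fintype α] [Fintype β] (P : α → ℝ) (Q : β → ℝ) (ν : ℝ) (n : ℕ) : ℕ :=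
  sSup {L : ℕ | ν ≤ FD (iid P n) (iid Q L)}

/-- The optimal second order rate `R^D_2(P,Q|ν)`. -/
noncomputable def RD2 [Fintype α] [Fintype β] (P : α → ℝ) (Q : β → ℝ) (ν : ℝ) : ℝ :=
  sSup {b : ℝ | ∃ c : ℝ, ν ≤ c ∧
    Tendsto (fun n : ℕ =>
      FD (iid P n) (iid Q (⌊H P / H Q * n + b * Real.sqrt n⌋₊))) atTop (nhds c)}

/-! ### Partial sums, majorization and fidelity -/

lemma topSum_finite [Fintype α] (P : α → ℝ) (l : ℕ) :
    {s : ℝ | ∃ A : Finset α, A.card ≤ l ∧ s = ∑ x ∈ A, P x}.Finite :=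
  (Set.finite_range fun A : Finset α => ∑ x ∈ A, P x).subset (by
    rintro s ⟨A, -, rfl⟩
    exact ⟨A, rfl⟩)

lemma sum_le_topSum [Fintype α] (P : α → ℝ) {l : ℕ} {A : Finset α} (hA : A.card ≤ l) :
    ∑ x ∈ A, P x ≤ topSum P l :=
  le_csSup (topSum_finite P l).bddAbove ⟨A, hA, rfl⟩

lemma exists_sum_eq_topSum [Fintype α] (P : α → ℝ) (l : ℕ) :
    ∃ A : Finset α, A.card ≤ l ∧ topSum P l = ∑ x ∈ A, P x :=
  Set.Nonempty.csSup_mem (s := {s : ℝ | ∃ A : Finset α, A.card ≤ l ∧ s = ∑ x ∈ A, P x})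
    ⟨0, ∅, by simp⟩ (topSum_finite P l)

lemma push_nonneg [Fintype α] (W : α → β) {P : α → ℝ} (hP : ∀ x, 0 ≤ P x) (y : β) :
    0 ≤ push W P y :=
  Finset.sum_nonneg fun x _ => by split_ifs <;> simp [hP x]

lemma isProb_push [Fintype α] [Fintype β] (W : α → β) {P : α → ℝ} (hP : IsProb P) :
    IsProb (push W P) := by
  classical
  refine ⟨push_nonneg W hP.1, ?_⟩
  unfold push
  rw [Finset.sum_comm, ← hP.2]
  exact Finset.sum_congr rfl fun x _ => by
    rw [Finset.sum_ite_eq, if_pos (Finset.mem_univ _)]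

lemma maj_push [Fintype α] [Fintype β] (W : α → β) {P : α → ℝ} (hP : IsProb P) :
    Maj P (push W P) := by
  classical
  intro l
  obtain ⟨A, hA, hAs⟩ := exists_sum_eq_topSum P l
  rw [hAs]
  refine le_trans ?_ (sum_le_topSum _ (A := A.image W) (Finset.card_image_le.trans hA))
  simp only [push]
  rw [Finset.sum_comm]
  refine (Finset.sum_le_sum fun x hx => ?_).trans
    (Finset.sum_le_sum_of_subset_of_nonneg (Finset.subset_univ A) fun x _ _ =>
      Finset.sum_nonneg fun y _ => by split_ifs <;> simp [hP.1 x])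
  rw [Finset.sum_ite_eq, if_pos (Finset.mem_image_of_mem W hx)]

lemma sum_sqrt_mul_const_le (B : Finset β) {R : β → ℝ} (hR : ∀ y, 0 ≤ R y) {c : ℝ} (hc : 0 ≤ c) :
    ∑ y ∈ B, √(R y * c) ≤ √((∑ y ∈ B, R y) * (B.card * c)) := by
  have h := Real.sum_sqrt_mul_sqrt_le B hR (fun _ => hc)
  simp only [Finset.sum_const, nsmul_eq_mul] at h
  rw [Real.sqrt_mul (Finset.sum_nonneg fun y _ => hR y)]
  simpa only [Real.sqrt_mul (hR _)] using h

/-- A distribution majorizing `P` has fidelity with the uniform distribution bounded in terms of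
the mass of any set of few points under `P`. -/
lemma fid_const_le_of_maj [Fintype α] [Fintype β] {P : α → ℝ} {R : β → ℝ}
    (hR : IsProb R) (hPR : Maj P R) {c : ℝ} (hc : 0 ≤ c) (hcβ : Fintype.card β * c = 1)
    (A : Finset α) :
    fid R (fun _ => c) ≤ √(A.card * c) + √(1 - ∑ x ∈ A, P x) := by
  classical
  obtain ⟨B, hB, hBs⟩ := exists_sum_eq_topSum R A.card
  have hAB : ∑ x ∈ A, P x ≤ ∑ y ∈ B, R y :=
    hBs ▸ (sum_le_topSum P le_rfl).trans (hPR A.card)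
  have hsum : ∑ y ∈ B, R y + ∑ y ∈ Bᶜ, R y = 1 := by rw [Finset.sum_add_sum_compl, hR.2]
  have hBc : 0 ≤ ∑ y ∈ Bᶜ, R y := Finset.sum_nonneg fun y _ => hR.1 y
  have hB0 : 0 ≤ ∑ y ∈ B, R y := Finset.sum_nonneg fun y _ => hR.1 y
  have hcard : (B.card : ℝ) ≤ A.card := by exact_mod_cast hB
  have hcard' : ((Bᶜ.card : ℕ) : ℝ) ≤ Fintype.card β := by exact_mod_cast Finset.card_le_univ _
  rw [fid, ← Finset.sum_add_sum_compl B]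
  refine add_le_add ((sum_sqrt_mul_const_le B hR.1 hc).trans (Real.sqrt_le_sqrt ?_))
    ((sum_sqrt_mul_const_le Bᶜ hR.1 hc).trans (Real.sqrt_le_sqrt ?_))
  · calc _ ≤ 1 * (A.card * c) := by gcongr; linarith
      _ = _ := one_mul _
  · calc _ ≤ (∑ y ∈ Bᶜ, R y) * (Fintype.card β * c) := by gcongr
      _ ≤ _ := by rw [hcβ]; linarith

lemma fid_const_le_one [Fintype β] {R : β → ℝ} (hR : IsProb R) {c : ℝ} (hc : 0 ≤ c)
    (hcβ : Fintype.card β * c = 1) : fid R (fun _ => c) ≤ 1 := by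
  refine (sum_sqrt_mul_const_le Finset.univ hR.1 hc).trans ?_
  rw [hR.2, Finset.card_univ, hcβ]
  simp

lemma FM_const_le [Fintype α] [Fintype β] (P : α → ℝ) {c : ℝ} (hc : 0 ≤ c)
    (hcβ : Fintype.card β * c = 1) (A : Finset α) :
    FM P (fun _ : β => c) ≤ √(A.card * c) + √(1 - ∑ x ∈ A, P x) := by
  refine Real.sSup_le ?_ (by positivity)
  rintro r ⟨R, hR, hPR, rfl⟩
  exact fid_const_le_of_maj hR hPR hc hcβ A

lemma FD_const_le_FM [Fintype α] [Fintype β] {P : α → ℝ} (hP : IsProb P) {c : ℝ} (hc : 0 ≤ c)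
    (hcβ : Fintype.card β * c = 1) : FD P (fun _ : β => c) ≤ FM P (fun _ : β => c) := by
  refine Real.sSup_le ?_ (Real.sSup_nonneg ?_)
  · rintro r ⟨W, rfl⟩
    refine le_csSup ⟨1, ?_⟩ ⟨_, isProb_push W hP, maj_push W hP, rfl⟩
    rintro r ⟨R, hR, -, rfl⟩
    exact fid_const_le_one hR hc hcβ
  · rintro r ⟨R, hR, -, rfl⟩
    exact Finset.sum_nonneg fun y _ => Real.sqrt_nonneg _

/-! ### Distributing small masses evenly -/

/-- Small nonnegative weights contain a subset of total weight just below any given level. -/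
lemma exists_subset_sum_near [DecidableEq α] (w : α → ℝ) (S : Finset α) {δ c : ℝ}
    (hδ : ∀ x ∈ S, w x ≤ δ) (hc : 0 ≤ c) :
    ∃ T ⊆ S, ∑ x ∈ T, w x ≤ c ∧ (c - δ ≤ ∑ x ∈ T, w x ∨ T = S) := by
  induction S using Finset.induction_on with
  | empty => exact ⟨∅, by simp, by simpa using hc, Or.inr rfl⟩
  | insert a S ha ih =>
    obtain ⟨T, hTS, hTc, hT⟩ := ih fun x hx => hδ x (Finset.mem_insert_of_mem hx)
    by_cases h : c - δ ≤ ∑ x ∈ T, w x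
    · exact ⟨T, hTS.trans (Finset.subset_insert a S), hTc, Or.inl h⟩
    · obtain rfl := hT.resolve_left h
      refine ⟨insert a T, subset_rfl, ?_, Or.inr rfl⟩
      rw [Finset.sum_insert ha]
      linarith [hδ a (Finset.mem_insert_self a T)]

/-- Weights at most `δ` with total at least `|B| c` can be put into bins indexed by `B` such that
each bin receives at least `c - δ`. -/
lemma exists_bins [DecidableEq α] [DecidableEq β] [Nonempty β] {w : α → ℝ} (hw : ∀ x, 0 ≤ w x)
    {δ c : ℝ} (hδ0 : 0 ≤ δ) (hc : 0 ≤ c) (B : Finset β) (S : Finset α) (hδ : ∀ x ∈ S, w x ≤ δ)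
    (hS : B.card * c ≤ ∑ x ∈ S, w x) :
    ∃ W : α → β, ∀ y ∈ B, c - δ ≤ ∑ x ∈ S with W x = y, w x := by
  induction B using Finset.induction_on generalizing S with
  | empty => exact ⟨fun _ => Classical.arbitrary β, by simp⟩
  | insert y B hy ih =>
    rw [Finset.card_insert_of_notMem hy] at hS
    push_cast at hS
    obtain ⟨T, hTS, hTc, hT⟩ := exists_subset_sum_near w S hδ hc
    have hT' : c - δ ≤ ∑ x ∈ T, w x := by
      rcases hT with hT | rfl
      · exact hT
      · have : 0 ≤ B.card * c := by positivity
        linarith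
    have hsplit := Finset.sum_sdiff (f := w) hTS
    obtain ⟨W, hW⟩ := ih (S \ T) (fun x hx => hδ x (Finset.sdiff_subset hx)) (by linarith)
    refine ⟨fun x => if x ∈ T then y else W x, fun z hz => ?_⟩
    rcases Finset.mem_insert.1 hz with rfl | hz
    · refine hT'.trans (Finset.sum_le_sum_of_subset_of_nonneg (fun x hx => ?_) fun x _ _ => hw x)
      simp [hx, hTS hx]
    · refine (hW z hz).trans (Finset.sum_le_sum_of_subset_of_nonneg (fun x hx => ?_)
        fun x _ _ => hw x)
      simp only [Finset.mem_filter, Finset.mem_sdiff] at hx ⊢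
      simp [hx]

/-- If the points of `S` have mass at most `δ`, then a deterministic map achieves large fidelity
with the uniform distribution. -/
lemma le_FD_const [Fintype α] [Fintype β] {P : α → ℝ} (hP : IsProb P) {c δ : ℝ} (hc : 0 ≤ c)
    (hcβ : Fintype.card β * c = 1) (hδ0 : 0 ≤ δ) (S : Finset α) (hδ : ∀ x ∈ S, P x ≤ δ) :
    √(∑ x ∈ S, P x - Fintype.card β * δ) ≤ FD P (fun _ : β => c) := by
  classical
  have hne : Nonempty β := by
    by_contra h
    rw [not_nonempty_iff] at h
    simp at hcβ
  have hp : 0 ≤ ∑ x ∈ S, P x := Finset.sum_nonneg fun x _ => hP.1 x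
  obtain ⟨W, hW⟩ := exists_bins (β := β) hP.1 hδ0 (mul_nonneg hp hc) Finset.univ S hδ (by
    rw [Finset.card_univ, mul_left_comm, hcβ, mul_one])
  refine le_trans ?_ (le_csSup (Set.Finite.bddAbove ((Set.finite_range fun W : α → β =>
    fid (push W P) fun _ => c).subset ?_)) ⟨W, rfl⟩)
  · have hpush : ∀ y, (∑ x ∈ S, P x) * c - δ ≤ push W P y := fun y => by
      refine (hW y (Finset.mem_univ y)).trans ?_
      rw [Finset.sum_filter, push]
      refine (Finset.sum_le_sum_of_subset_of_nonneg (Finset.subset_univ S) fun x _ _ => ?_).trans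
        (le_of_eq (Finset.sum_congr rfl fun x _ => by congr))
      split_ifs <;> simp [hP.1 x]
    have hN : (0 : ℝ) ≤ Fintype.card β := by positivity
    calc √(∑ x ∈ S, P x - Fintype.card β * δ)
        = √((Fintype.card β : ℝ) ^ 2 * (((∑ x ∈ S, P x) * c - δ) * c)) := by
          congr 1
          linear_combination (-(∑ x ∈ S, P x) * (Fintype.card β * c + 1)
            + Fintype.card β * δ) * hcβ
      _ = ∑ _y : β, √(((∑ x ∈ S, P x) * c - δ) * c) := by
          rw [Real.sqrt_mul (sq_nonneg _), Real.sqrt_sq hN]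
          simp
      _ ≤ fid (push W P) fun _ => c :=
          Finset.sum_le_sum fun y _ => Real.sqrt_le_sqrt (by gcongr; exact hpush y)
  · rintro r ⟨W, rfl⟩
    exact ⟨W, rfl⟩

/-! ### Product distributions -/

lemma iid_nonneg [Fintype α] {P : α → ℝ} (hP : IsProb P) (n : ℕ) (f : Fin n → α) :
    0 ≤ iid P n f :=
  Finset.prod_nonneg fun i _ => hP.1 (f i)

lemma isProb_iid [Fintype α] {P : α → ℝ} (hP : IsProb P) (n : ℕ) : IsProb (iid P n) := by
  classical
  refine ⟨iid_nonneg hP n, ?_⟩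
  simp only [iid]
  rw [← Fintype.piFinset_univ, ← Finset.prod_univ_sum]
  simp [hP.2]

lemma iid_U2 (L : ℕ) : iid U2 L = fun _ => (1 / 2 : ℝ) ^ L := by
  ext f
  simp [iid, U2]

lemma card_le_of_le_mass [Fintype α] {P : α → ℝ} (hP : IsProb P) {s : ℝ} :
    (Finset.univ.filter fun x => s ≤ P x).card * s ≤ 1 := by
  rw [← hP.2, ← nsmul_eq_mul]
  exact (Finset.card_nsmul_le_sum _ P s fun x hx => (Finset.mem_filter.1 hx).2).trans
    (Finset.sum_le_sum_of_subset_of_nonneg (Finset.subset_univ _) fun x _ _ => hP.1 x)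

lemma neg_mul_logb_nonneg [Fintype α] {P : α → ℝ} (hP : IsProb P) (x : α) :
    0 ≤ -(P x * Real.logb 2 (P x)) := by
  have h1 : P x ≤ 1 := hP.2 ▸ Finset.single_le_sum (fun i _ => hP.1 i) (Finset.mem_univ x)
  have := Real.logb_nonpos (b := 2) (by norm_num) (hP.1 x) h1
  nlinarith [hP.1 x]

lemma H2_pos [Fintype α] {P : α → ℝ} (hP : IsProb P) (hV : 0 < V2 P) : 0 < H2 P := by
  refine lt_of_le_of_ne (Finset.sum_nonneg fun x _ => neg_mul_logb_nonneg hP x) fun h => hV.ne' ?_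
  have hz := (Finset.sum_eq_zero_iff_of_nonneg fun x _ => neg_mul_logb_nonneg hP x).1 h.symm
  refine Finset.sum_eq_zero fun x hx => ?_
  have := hz x hx
  rw [← h]
  linear_combination (Real.logb 2 (P x)) * (-this)

/-! ### Central limit theorem for the self-information -/

open ProbabilityTheory Topology

/-- `P` as a probability mass function. -/
noncomputable def IsProb.toPMF [Fintype α] {P : α → ℝ} (hP : IsProb P) : PMF α :=
  PMF.ofFintype (fun x => ENNReal.ofReal (P x)) (by
    rw [← ENNReal.ofReal_sum_of_nonneg fun x _ => hP.1 x, hP.2, ENNReal.ofReal_one])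

lemma IsProb.integral_toPMF [Fintype α] [MeasurableSpace α] [MeasurableSingletonClass α]
    {P : α → ℝ} (hP : IsProb P) (f : α → ℝ) : ∫ x, f x ∂hP.toPMF.toMeasure = ∑ x, P x * f x := by
  rw [PMF.integral_eq_sum]
  simp [IsProb.toPMF, ENNReal.toReal_ofReal (hP.1 _)]

lemma infinitePi_toPMF_real [Fintype α] [MeasurableSpace α] [MeasurableSingletonClass α]
    {P : α → ℝ} (hP : IsProb P) (n : ℕ) (A : Finset (Fin n → α)) :
    (Measure.infinitePi fun _ : ℕ => hP.toPMF.toMeasure).real {ω | (fun i : Fin n => ω i) ∈ A} =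
      ∑ f ∈ A, iid P n f := by
  have hind : iIndepFun (fun (i : ℕ) (ω : ℕ → α) => ω i)
      (Measure.infinitePi fun _ : ℕ => hP.toPMF.toMeasure) :=
    iIndepFun_infinitePi (X := fun _ x => x) fun _ => measurable_id
  have hpi := (hind.precomp (g := fun i : Fin n => (i : ℕ)) Fin.val_injective).map_fun_eq_pi_map
    fun i => (measurable_pi_apply _).aemeasurable
  simp only [Measure.infinitePi_map_eval] at hpi
  have hset : {ω : ℕ → α | (fun i : Fin n => ω i) ∈ A} =
      (fun ω (i : Fin n) => ω i) ⁻¹' (A : Set (Fin n → α)) := rfl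
  have hmeas : Measurable fun (ω : ℕ → α) (i : Fin n) => ω i := by fun_prop
  rw [hset, ← map_measureReal_apply hmeas A.measurableSet]
  erw [hpi]
  rw [measureReal_def, ← sum_measure_singleton,
    ENNReal.toReal_sum fun f _ => measure_ne_top _ _]
  refine Finset.sum_congr rfl fun f _ => ?_
  rw [Measure.pi_singleton, ENNReal.toReal_prod, iid]
  refine Finset.prod_congr rfl fun i _ => ?_
  rw [PMF.toMeasure_apply_singleton _ _ (measurableSet_singleton _), IsProb.toPMF,
    PMF.ofFintype_apply, ENNReal.toReal_ofReal (hP.1 _)]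

lemma gaussianReal_real_Iic {v : NNReal} (hv : v ≠ 0) (b : ℝ) :
    (gaussianReal 0 v).real (Set.Iic b) = stdG (b / √v) := by
  have hs : 0 < √(v : ℝ) := Real.sqrt_pos.2 (by positivity)
  have hmap := gaussianReal_map_const_mul (μ := 0) (v := 1) (√(v : ℝ))
  have hv' : NNReal.mk (√(v : ℝ) ^ 2) (sq_nonneg _) * 1 = v := by
    ext
    simp
  rw [mul_zero, hv'] at hmap
  rw [← hmap, map_measureReal_apply (by fun_prop) measurableSet_Iic]
  have hset : (fun x => √(v : ℝ) * x) ⁻¹' Set.Iic b = Set.Iic (b / √v) := by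
    ext x
    simp [le_div_iff₀ hs, mul_comm]
  rw [hset, measureReal_def, gaussianReal_apply_eq_integral _ one_ne_zero, ENNReal.toReal_ofReal]
  · simp [stdG, normalPDF, gaussianPDFReal]
  · exact integral_nonneg fun x => gaussianPDFReal_nonneg _ _ _

/-- The mass under `P ^ n` of the sequences of self-information at most `h n`. -/
lemma tendsto_sum_iid_neg_logb_le [Fintype α] {P : α → ℝ} (hP : IsProb P) (hV : 0 < V2 P) {b : ℝ}
    {h : ℕ → ℝ} (hh : Tendsto (fun n : ℕ => (h n - H2 P * n) / √n) atTop (𝓝 b)) :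
    Tendsto (fun n : ℕ => ∑ f : Fin n → α with ∑ i, -Real.logb 2 (P (f i)) ≤ h n, iid P n f)
      atTop (𝓝 (stdG (b / √(V2 P)))) := by
  let _ : MeasurableSpace α := ⊤
  have : MeasurableSingletonClass α := ⟨fun _ => trivial⟩
  set ν := Measure.infinitePi fun _ : ℕ => hP.toPMF.toMeasure
  set X : ℕ → (ℕ → α) → ℝ := fun k ω => -Real.logb 2 (P (ω k)) with hX
  have hmeas : Measurable fun x : α => -Real.logb 2 (P x) := measurable_of_finite _
  have hXm : ∀ k, Measurable (X k) := fun k => hmeas.comp (measurable_pi_apply k)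
  have hint : ∀ (g : α → ℝ) (k : ℕ), ∫ ω, g (ω k) ∂ν = ∑ x, P x * g x := fun g k => by
    rw [← hP.integral_toPMF, ← Measure.infinitePi_map_eval (fun _ : ℕ => hP.toPMF.toMeasure) k,
      integral_map (measurable_pi_apply k).aemeasurable
        (measurable_of_finite g).aestronglyMeasurable]
  have hmean : ν[X 0] = H2 P := by
    rw [hX, hint (fun x => -Real.logb 2 (P x)) 0]
    simp [H2]
  have hvar : Var[X 0; ν] = V2 P := by
    rw [variance_eq_integral (hXm 0).aemeasurable, hmean, hX,
      hint (fun x => (-Real.logb 2 (P x) - H2 P) ^ 2) 0, V2]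
  have hv : (V2 P).toNNReal ≠ 0 := by simpa using hV
  have hL2 : MemLp (X 0) 2 ν := memLp_two_of_variance_ne_zero
    (hXm 0).aestronglyMeasurable (hvar ▸ hV.ne')
  have hind : iIndepFun X ν :=
    iIndepFun_infinitePi (X := fun _ x => -Real.logb 2 (P x)) fun _ => hmeas
  have hident : ∀ k, IdentDistrib (X k) (X 0) ν ν := fun k =>
    IdentDistrib.comp (u := fun x => -Real.logb 2 (P x)) (f := fun ω : ℕ → α => ω k)
      (g := fun ω : ℕ → α => ω 0) ⟨(measurable_pi_apply k).aemeasurable,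
        (measurable_pi_apply 0).aemeasurable, by
        rw [Measure.infinitePi_map_eval, Measure.infinitePi_map_eval]⟩ hmeas
  have hclt := tendstoInDistribution_inv_sqrt_mul_sum_sub (Y := id)
    (P' := gaussianReal 0 (V2 P).toNNReal) (by rw [hvar]; exact HasLaw.id) hL2 hind hident
  have hconst : TendstoInMeasure ν (fun (n : ℕ) (_ : ℕ → α) => -((h n - H2 P * n) / √n)) atTop
      fun _ => -b :=
    tendstoInMeasure_of_tendsto_ae (fun n => aestronglyMeasurable_const)
      (ae_of_all _ fun _ => hh.neg)
  have hsum := (hclt.add_of_tendstoInMeasure_const hconst fun n => aemeasurable_const).tendsto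
  have hset : (fun ω : ℝ => id ω + -b) ⁻¹' Set.Iic 0 = Set.Iic b := by
    ext x
    simp
  have hlim := ProbabilityMeasure.tendsto_measure_of_null_frontier_of_tendsto' hsum
    (E := Set.Iic 0) (by
      have := nullSingletonClass_gaussianReal (μ := 0) hv
      simp only [ProbabilityMeasure.coe_mk, frontier_Iic]
      rw [Measure.map_apply (by fun_prop) (measurableSet_singleton _)]
      have : (fun ω : ℝ => id ω + -b) ⁻¹' {0} = {b} := by
        ext x
        simp [← sub_eq_add_neg, sub_eq_zero]
      rw [this, measure_singleton])
  simp only [ProbabilityMeasure.coe_mk] at hlim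
  rw [Measure.map_apply (by fun_prop) measurableSet_Iic, hset] at hlim
  have hlim' := (ENNReal.tendsto_toReal (measure_ne_top _ _)).comp hlim
  rw [← measureReal_def, gaussianReal_real_Iic hv, Real.coe_toNNReal _ hV.le] at hlim'
  refine hlim'.congr' ?_
  filter_upwards [eventually_gt_atTop 0] with n hn
  have hs : 0 < √(n : ℝ) := Real.sqrt_pos.2 (by exact_mod_cast hn)
  rw [← infinitePi_toPMF_real hP, Function.comp_apply, Measure.map_apply_of_aemeasurable _
    measurableSet_Iic, ← measureReal_def]
  · congr 1
    ext ω
    simp only [Set.mem_preimage, Set.mem_Iic, Pi.add_apply, Finset.mem_filter, Finset.mem_univ,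
      true_and, Set.mem_ofPred_eq, hmean]
    rw [← sub_eq_add_neg, sub_nonpos, inv_mul_le_iff₀ hs, mul_div_cancel₀ _ hs.ne', mul_comm (n : ℝ),
      sub_le_sub_iff_right, Finset.sum_range]
  · exact (Measurable.add (Measurable.const_mul ((Finset.measurable_fun_sum _
      fun k _ => hXm k).sub measurable_const) _) measurable_const).aemeasurable

lemma rpow_neg_le_iid_iff [Fintype α] {P : α → ℝ} {n : ℕ} {f : Fin n → α} {s : ℝ}
    (hf : ∀ i, 0 < P (f i)) :
    (2 : ℝ) ^ (-s) ≤ iid P n f ↔ ∑ i, -Real.logb 2 (P (f i)) ≤ s := by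
  rw [Finset.sum_neg_distrib, iid, ← Real.le_logb_iff_rpow_le one_lt_two
    (Finset.prod_pos fun i _ => hf i), Real.logb_prod _ _ fun i _ => (hf i).ne', neg_le]

/-- The mass under `P ^ n` of the sequences of probability at least `2 ^ (-h n)`. -/
lemma tendsto_sum_iid_ge [Fintype α] {P : α → ℝ} (hP : IsProb P) (hV : 0 < V2 P) {b : ℝ}
    {h : ℕ → ℝ} (hh : Tendsto (fun n : ℕ => (h n - H2 P * n) / √n) atTop (𝓝 b)) :
    Tendsto (fun n : ℕ => ∑ f : Fin n → α with (2 : ℝ) ^ (-h n) ≤ iid P n f, iid P n f)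
      atTop (𝓝 (stdG (b / √(V2 P)))) := by
  refine (tendsto_sum_iid_neg_logb_le hP hV hh).congr fun n => ?_
  rw [Finset.sum_filter, Finset.sum_filter]
  refine Finset.sum_congr rfl fun f _ => ?_
  by_cases hf : ∀ i, 0 < P (f i)
  · simp only [rpow_neg_le_iid_iff hf]
  · push Not at hf
    obtain ⟨i, hi⟩ := hf
    have : iid P n f = 0 := Finset.prod_eq_zero (Finset.mem_univ i) (le_antisymm hi (hP.1 _))
    simp [this]

/-! ### The number of extracted bits -/

lemma tendsto_floor_sub_div_sqrt {a : ℝ} (ha : 0 < a) (b : ℝ) :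
    Tendsto (fun n : ℕ => ((⌊a * n + b * √n⌋₊ : ℝ) - a * n) / √n) atTop (𝓝 b) := by
  have hsq : Tendsto (fun n : ℕ => √(n : ℝ)) atTop atTop :=
    Real.tendsto_sqrt_atTop.comp tendsto_natCast_atTop_atTop
  have hlow : Tendsto (fun n : ℕ => b - 1 / √(n : ℝ)) atTop (𝓝 b) := by
    simpa using tendsto_const_nhds.sub (hsq.inv_tendsto_atTop)
  have hpos : ∀ᶠ n : ℕ in atTop, 0 ≤ a * n + b * √(n : ℝ) := by
    filter_upwards [hsq.eventually_ge_atTop (-b / a)] with n hn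
    have h1 : 0 ≤ a * √(n : ℝ) + b := by
      rw [div_le_iff₀ ha] at hn
      linarith
    have h2 := mul_nonneg h1 (Real.sqrt_nonneg n)
    have h3 := Real.mul_self_sqrt (Nat.cast_nonneg (α := ℝ) n)
    nlinarith
  refine tendsto_of_tendsto_of_tendsto_of_le_of_le' hlow tendsto_const_nhds ?_ ?_
  · filter_upwards [hsq.eventually_gt_atTop 0] with n hn
    rw [le_div_iff₀ hn, sub_mul, div_mul_cancel₀ _ hn.ne']
    linarith [Nat.lt_floor_add_one (a * n + b * √(n : ℝ))]
  · filter_upwards [hpos, hsq.eventually_gt_atTop 0] with n hn hn0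
    rw [div_le_iff₀ hn0]
    linarith [Nat.floor_le hn]

lemma tendsto_sqrt_sqrt_div_sqrt :
    Tendsto (fun n : ℕ => √√(n : ℝ) / √n) atTop (𝓝 0) := by
  have : Tendsto (fun n : ℕ => (√√(n : ℝ))⁻¹) atTop (𝓝 0) :=
    (Real.tendsto_sqrt_atTop.comp
      (Real.tendsto_sqrt_atTop.comp tendsto_natCast_atTop_atTop)).inv_tendsto_atTop
  refine this.congr fun n => ?_
  rw [Real.sqrt_div_self', one_div]

lemma tendsto_two_rpow_neg_sqrt_sqrt :
    Tendsto (fun n : ℕ => (2 : ℝ) ^ (-√√(n : ℝ))) atTop (𝓝 0) :=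
  (tendsto_rpow_atBot_of_base_gt_one 2 one_lt_two).comp (tendsto_neg_atTop_atBot.comp
    (Real.tendsto_sqrt_atTop.comp
      (Real.tendsto_sqrt_atTop.comp tendsto_natCast_atTop_atTop)))

/-- second order asymptotics of the uniform random number generation
(entropy and varentropy in base 2). -/
theorem second_order_uniform_target {X : Type*} [Fintype X]
    (P : X → ℝ) (hP : IsProb P) (hV : 0 < V2 P) (b : ℝ) :
    Tendsto (fun n : ℕ =>
        FD (iid P n) (iid U2 ⌊H2 P * n + b * Real.sqrt n⌋₊)) atTop
      (nhds (Real.sqrt (1 - stdG (b / Real.sqrt (V2 P))))) ∧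
    Tendsto (fun n : ℕ =>
        FM (iid P n) (iid U2 ⌊H2 P * n + b * Real.sqrt n⌋₊)) atTop
      (nhds (Real.sqrt (1 - stdG (b / Real.sqrt (V2 P))))) := by
  set L : ℕ → ℕ := fun n => ⌊H2 P * n + b * √n⌋₊
  set K : ℕ → ℝ := fun n => √√(n : ℝ)
  have hL : Tendsto (fun n : ℕ => ((L n : ℝ) - H2 P * n) / √n) atTop (nhds b) :=
    tendsto_floor_sub_div_sqrt (H2_pos hP hV) b
  have hup := tendsto_sum_iid_ge hP hV (h := fun n => L n - K n) (b := b) (by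
    have := hL.sub tendsto_sqrt_sqrt_div_sqrt
    rw [sub_zero] at this
    refine this.congr fun n => ?_
    ring)
  have hlo := tendsto_sum_iid_ge hP hV (h := fun n => L n + K n) (b := b) (by
    have := hL.add tendsto_sqrt_sqrt_div_sqrt
    rw [add_zero] at this
    refine this.congr fun n => ?_
    ring)
  have hcard : ∀ n, (Fintype.card (Fin (L n) → Fin 2) : ℝ) * (1 / 2) ^ L n = 1 := fun n => by
    simp
  have hc : ∀ n, (0 : ℝ) ≤ (1 / 2) ^ L n := fun n => by positivity
  have hle : ∀ n, FD (iid P n) (iid U2 (L n)) ≤ FM (iid P n) (iid U2 (L n)) := fun n => by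
    rw [iid_U2]
    exact FD_const_le_FM (isProb_iid hP n) (hc n) (hcard n)
  have hFM : ∀ n, FM (iid P n) (iid U2 (L n)) ≤ √((2 : ℝ) ^ (-K n)) +
      √(1 - ∑ f : Fin n → X with (2 : ℝ) ^ (-(L n - K n)) ≤ iid P n f, iid P n f) := fun n => by
    rw [iid_U2]
    refine (FM_const_le (iid P n) (hc n) (hcard n) _).trans
      (add_le_add_left (Real.sqrt_le_sqrt ?_) _)
    have h1 := card_le_of_le_mass (isProb_iid hP n) (s := (2 : ℝ) ^ (-((L n : ℝ) - K n)))
    have h2 : (1 / 2 : ℝ) ^ L n = 2 ^ (-((L n : ℝ) - K n)) * 2 ^ (-K n) := by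
      rw [← Real.rpow_add two_pos, one_div, inv_pow, ← Real.rpow_natCast, ← Real.rpow_neg two_pos.le]
      ring_nf
    rw [h2, ← mul_assoc]
    exact mul_le_of_le_one_left (by positivity) h1
  have hFD : ∀ n, √(1 - (∑ f : Fin n → X with (2 : ℝ) ^ (-(L n + K n)) ≤ iid P n f, iid P n f) -
      2 ^ (-K n)) ≤ FD (iid P n) (iid U2 (L n)) := fun n => by
    rw [iid_U2]
    refine le_trans (Real.sqrt_le_sqrt (le_of_eq ?_)) (le_FD_const (isProb_iid hP n) (hc n)
      (hcard n) (δ := 2 ^ (-((L n : ℝ) + K n))) (by positivity)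
      (Finset.univ.filter fun f => ¬ (2 : ℝ) ^ (-((L n : ℝ) + K n)) ≤ iid P n f)
      fun f hf => (not_le.1 (Finset.mem_filter.1 hf).2).le)
    have h1 := Finset.sum_filter_add_sum_filter_not Finset.univ
      (fun f => (2 : ℝ) ^ (-((L n : ℝ) + K n)) ≤ iid P n f) (iid P n)
    rw [(isProb_iid hP n).2] at h1
    have h2 : (Fintype.card (Fin (L n) → Fin 2) : ℝ) * 2 ^ (-((L n : ℝ) + K n)) = 2 ^ (-K n) := by
      rw [neg_add, Real.rpow_add two_pos, ← mul_assoc, Real.rpow_neg two_pos.le, Real.rpow_natCast]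
      simp
    rw [h2]
    linarith
  have hupper := ((Real.continuous_sqrt.tendsto _).comp tendsto_two_rpow_neg_sqrt_sqrt).add
    ((Real.continuous_sqrt.tendsto _).comp (hup.const_sub 1))
  have hlower := (Real.continuous_sqrt.tendsto _).comp
    ((hlo.const_sub 1).sub tendsto_two_rpow_neg_sqrt_sqrt)
  rw [sub_zero] at hlower
  rw [Real.sqrt_zero, zero_add] at hupper
  exact ⟨tendsto_of_tendsto_of_tendsto_of_le_of_le hlower hupper hFD fun n => (hle n).trans (hFM n),
    tendsto_of_tendsto_of_tendsto_of_le_of_le hlower hupper (fun n => (hFD n).trans (hle n)) hFM⟩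

end RNG
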